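/- Let E = ℤ[X]/(X² − X + 1) be the Eisenstein integers, with ζ the class of X. Let a, b ∈ ℤ be such that p = a² + ab + b² is a rational prime with p ≡ 1 (mod 3), set π = a + bζ, and let n ≥ 1. Then the quotient ring E/(π^n) is isomorphic as a ring to ℤ/p^nℤ (i.e., to ZMod (p^n)). -/

import Mathlib

open Polynomial

/-- The Eisenstein integers `ℤ[X]/(X² - X + 1)`. -/
noncomputable abbrev Eisenstein : Type :=
  AdjoinRoot ((X : ℤ[X]) ^ 2 - X + 1)

/-- The class `ζ` of `X` in the Eisenstein integers. -/
noncomputable abbrev eisensteinZeta : Eisenstein :=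
  AdjoinRoot.root ((X : ℤ[X]) ^ 2 - X + 1)

theorem eis_zeta_sq : eisensteinZeta ^ 2 = eisensteinZeta - 1 := by
  have h : AdjoinRoot.mk ((X : ℤ[X]) ^ 2 - X + 1) ((X : ℤ[X]) ^ 2 - X + 1) = 0 :=
    AdjoinRoot.mk_self
  simp only [map_add, map_sub, map_pow, AdjoinRoot.mk_X, map_one] at h
  linear_combination h

theorem eis_exists (z : Eisenstein) : ∃ x y : ℤ, z = (x : Eisenstein) + y * eisensteinZeta := by
  induction z using AdjoinRoot.induction_on with
  | ih q =>
    induction q using Polynomial.induction_on' with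
    | add q r hq hr =>
      obtain ⟨x, y, h⟩ := hq
      obtain ⟨x', y', h'⟩ := hr
      refine ⟨x + x', y + y', ?_⟩
      rw [map_add, h, h']
      push_cast
      ring
    | monomial n s =>
      induction n with
      | zero => exact ⟨s, 0, by simp⟩
      | succ n ih =>
        obtain ⟨x, y, h⟩ := ih
        refine ⟨-y, x + y, ?_⟩
        rw [← Polynomial.monomial_mul_X, map_mul, h, AdjoinRoot.mk_X]
        push_cast
        linear_combination (y : Eisenstein) * eis_zeta_sq

theorem eis_zero (x y : ℤ) (h : (x : Eisenstein) + y * eisensteinZeta = 0) : x = 0 ∧ y = 0 := by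
  have hm : ((X : ℤ[X]) ^ 2 - X + 1).Monic := by monicity!
  have hd : ((X : ℤ[X]) ^ 2 - X + 1).degree = 2 := by compute_degree!
  have h1 : AdjoinRoot.mk ((X : ℤ[X]) ^ 2 - X + 1) (C y * X + C x) = 0 := by
    rw [← h]
    simp [add_comm]
  rw [AdjoinRoot.mk_eq_zero] at h1
  have h2 : (C y * X + C x : ℤ[X]) = 0 := by
    apply Polynomial.eq_zero_of_dvd_of_degree_lt h1
    rw [hd]
    exact lt_of_le_of_lt Polynomial.degree_linear_le (by norm_num)
  constructor
  · simpa using congrArg (fun q => Polynomial.coeff q 0) h2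
  · simpa [-eq_intCast, -map_intCast, Polynomial.coeff_C] using
      congrArg (fun q => Polynomial.coeff q 1) h2

theorem eis_quot (c d : ℤ) (N : ℕ) (hN : c ^ 2 + c * d + d ^ 2 = (N : ℤ))
    (hco : IsCoprime d (N : ℤ)) :
    Nonempty ((Eisenstein ⧸ Ideal.span {(c : Eisenstein) + (d : Eisenstein) * eisensteinZeta})
      ≃+* ZMod N) := by
  obtain ⟨u, v, huv⟩ := hco
  set I := Ideal.span {(c : Eisenstein) + (d : Eisenstein) * eisensteinZeta} with hI
  let f : ℤ →+* Eisenstein ⧸ I := Int.castRingHom _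
  have hNE : ((c : Eisenstein) ^ 2 + c * d + d ^ 2) = (N : ℤ) := by
    rw [← hN]; push_cast; ring
  have huvE : (u : Eisenstein) * d + v * (N : ℤ) = 1 := by exact_mod_cast congrArg (Int.cast (R := Eisenstein)) huv
  have hsurj : Function.Surjective f := by
    intro z
    obtain ⟨z, rfl⟩ := Ideal.Quotient.mk_surjective z
    obtain ⟨x, y, rfl⟩ := eis_exists z
    refine ⟨x - y * u * c, ?_⟩
    have : f (x - y * u * c) = Ideal.Quotient.mk I ((x - y * u * c : ℤ) : Eisenstein) := by
      simp [f]
    rw [this, Ideal.Quotient.eq, hI, Ideal.mem_span_singleton]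
    refine ⟨-(y * u) - y * v * eisensteinZeta * (c + d - d * eisensteinZeta), ?_⟩
    push_cast
    linear_combination (y * eisensteinZeta : Eisenstein) * huvE
      + (y * v * eisensteinZeta : Eisenstein) * hNE
      - (y * v * eisensteinZeta * d ^ 2 : Eisenstein) * eis_zeta_sq
  have hker : RingHom.ker f = Ideal.span {(N : ℤ)} := by
    ext m
    have : f m = Ideal.Quotient.mk I (m : Eisenstein) := by simp [f]
    rw [RingHom.mem_ker, this, Ideal.Quotient.eq_zero_iff_mem, hI, Ideal.mem_span_singleton,
      Ideal.mem_span_singleton]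
    constructor
    · rintro ⟨w, hw⟩
      obtain ⟨x, y, rfl⟩ := eis_exists w
      obtain ⟨h1, h2⟩ := eis_zero (x * c - y * d - m) (x * d + y * (c + d)) (by
        push_cast
        linear_combination -hw - (y * d : Eisenstein) * eis_zeta_sq)
      have hc : IsCoprime d (c + d) := ⟨u + v * d, v * c, by rw [← hN] at huv; linear_combination huv⟩
      have hdy : d ∣ y := hc.dvd_of_dvd_mul_right ⟨-x, by linear_combination h2⟩
      obtain ⟨k, rfl⟩ := hdy
      by_cases hd : d = 0
      · subst hd
        have : c ^ 2 = N := by linear_combination hN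
        have hu : IsUnit (N : ℤ) := IsUnit.of_mul_eq_one v (by linear_combination huv)
        exact hu.dvd
      · have hx : x = -k * (c + d) := by
          apply mul_left_cancel₀ hd
          linear_combination h2
        refine ⟨-k, ?_⟩
        rw [← hN]
        subst hx
        linear_combination -h1
    · rintro ⟨k, rfl⟩
      refine ⟨(c + d - d * eisensteinZeta) * k, ?_⟩
      rw [Int.cast_mul, ← hNE]
      linear_combination (d ^ 2 * k : Eisenstein) * eis_zeta_sq
  exact ⟨((RingHom.quotientKerEquivOfSurjective hsurj).symm.trans
    (Ideal.quotEquivOfEq hker)).trans (Int.quotientSpanNatEquivZMod N)⟩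

theorem eis_pow (a b p : ℤ) (hnorm : a ^ 2 + a * b + b ^ 2 = p) (n : ℕ) :
    ∃ c d : ℤ, ((a : Eisenstein) + (b : Eisenstein) * eisensteinZeta) ^ n
        = (c : Eisenstein) + (d : Eisenstein) * eisensteinZeta ∧
      c ^ 2 + c * d + d ^ 2 = p ^ n ∧
      p ∣ b * c + d * (a + b) - b * (2 * a + b) ^ n := by
  induction n with
  | zero => exact ⟨1, 0, by simp, by simp, by simp⟩
  | succ n ih =>
    obtain ⟨c, d, h1, h2, k, h3⟩ := ih
    refine ⟨c * a - d * b, c * b + d * a + d * b, ?_, ?_, (2 * a + b) * k - d, ?_⟩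
    · rw [pow_succ, h1]
      push_cast
      linear_combination (d * b : Eisenstein) * eis_zeta_sq
    · rw [pow_succ p n, ← h2, ← hnorm]
      ring
    · rw [pow_succ]
      linear_combination (2 * a + b) * h3 - d * hnorm

/-- If `π = a + bζ` is an irrational Eisenstein prime (its norm `p = a² + ab + b²`
being a rational prime congruent to `1 mod 3`) and `n ≥ 1`, then
`ℤ[ζ]/(π^n) ≅ ℤ/p^nℤ`. -/
theorem eisenstein_quotient_irrational_prime_power
    (a b : ℤ) (p : ℕ) (hp : p.Prime) (hp3 : p % 3 = 1)
    (hnorm : a ^ 2 + a * b + b ^ 2 = (p : ℤ)) (n : ℕ) (hn : 1 ≤ n) :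
    Nonempty
      ((Eisenstein ⧸
          Ideal.span {((a : Eisenstein) + (b : Eisenstein) * eisensteinZeta) ^ n}) ≃+*
        ZMod (p ^ n)) := by
  have hpp : Prime (p : ℤ) := Nat.prime_iff_prime_int.mp hp
  obtain ⟨c, d, h1, h2, h3⟩ := eis_pow a b p hnorm n
  rw [h1]
  have hb : ¬ (p : ℤ) ∣ b := by
    rintro ⟨k, rfl⟩
    have ha : (p : ℤ) ∣ a := hpp.dvd_of_dvd_pow (n := 2)
      ⟨1 - a * k - p * k ^ 2, by linear_combination hnorm⟩
    obtain ⟨l, rfl⟩ := ha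
    apply hpp.not_isUnit
    apply IsUnit.of_mul_eq_one (l ^ 2 + l * k + k ^ 2)
    apply mul_left_cancel₀ hpp.ne_zero
    linear_combination hnorm
  have ht : ¬ (p : ℤ) ∣ 2 * a + b := by
    rintro ⟨k, hk⟩
    have : (p : ℤ) ∣ 3 * b ^ 2 :=
      ⟨4 - p * k ^ 2, by linear_combination 4 * hnorm - (2 * a + b + p * k) * hk⟩
    rcases hpp.dvd_or_dvd this with h | h
    · have h' : p ∣ 3 := by exact_mod_cast h
      rw [Nat.prime_dvd_prime_iff_eq hp Nat.prime_three] at h'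
      omega
    · exact hb (hpp.dvd_of_dvd_pow h)
  have hd : ¬ (p : ℤ) ∣ d := by
    intro hd
    have hpn : (p : ℤ) ∣ p ^ n := dvd_pow_self _ (by omega)
    have hc : (p : ℤ) ∣ c := by
      apply hpp.dvd_of_dvd_pow (n := 2)
      have : c ^ 2 = p ^ n - d * (c + d) := by linear_combination h2
      rw [this]
      exact dvd_sub hpn (hd.mul_right _)
    have : (p : ℤ) ∣ b * (2 * a + b) ^ n := by
      have h := dvd_sub (dvd_add (hc.mul_left b) (hd.mul_right (a + b))) h3
      simpa using h
    rcases hpp.dvd_or_dvd this with h | h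
    · exact hb h
    · exact ht (hpp.dvd_of_dvd_pow h)
  apply eis_quot c d (p ^ n) (by rw [h2]; push_cast; rfl)
  push_cast
  exact (((hpp.irreducible.coprime_iff_not_dvd).mpr hd).symm).pow_right
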